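/- (Lévy's zero-one law, game-theoretic version.) Let X be a finite non-empty set with an imprecise probability tree and associated game-theoretic upper expectation Ē_V. For any bounded-below f : Ω → ℝ̄ and any situation s' ∈ X*, the event A := {ω ∈ Ω : liminf_{n→∞} Ē_V(f | ω^n) ≥ f(ω)} is strictly almost sure within Γ(s'); that is, there exists an s'-test supermartingale that converges to +∞ on Γ(s') \ A. -/

import Mathlib

open Filter Topology

/-- A function to the extended reals is bounded below by some real number. -/
def BddBelowF {Y : Type*} (f : Y → EReal) : Prop :=
  ∃ M : ℝ, ∀ y, (M : EReal) ≤ f y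

/-- An upper expectation on the bounded-below extended-real functions on `Y`:
axioms E1 (constants), E2 (subadditivity), E3 (positive/`+∞` homogeneity on
non-negative functions) and E4 (monotonicity). -/
structure IsUpperExpectation {Y : Type*} (E : (Y → EReal) → EReal) : Prop where
  const : ∀ c : ℝ, E (fun _ => (c : EReal)) = (c : EReal)
  subadd : ∀ f g : Y → EReal, BddBelowF f → BddBelowF g →
    E (fun y => f y + g y) ≤ E f + E g
  homog : ∀ lam : EReal, 0 < lam → ∀ f : Y → EReal, BddBelowF f → (∀ y, 0 ≤ f y) →
    E (fun y => lam * f y) = lam * E f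
  mono : ∀ f g : Y → EReal, BddBelowF f → BddBelowF g → (∀ y, f y ≤ g y) → E f ≤ E g

/-- The initial segment `ω^n = (ω_1, …, ω_n)` of a path `ω ∈ X^ℕ`. -/
def seg {X : Type*} (ω : ℕ → X) (n : ℕ) : List X :=
  List.ofFn (fun i : Fin n => ω i)

/-- The cylinder event `Γ(s)` of all paths going through the situation `s`. -/
def cyl {X : Type*} (s : List X) : Set (ℕ → X) :=
  {ω | seg ω s.length = s}

/-- A global variable is `n`-measurable if it only depends on the first `n` states. -/
def NMeas {X α : Type*} (n : ℕ) (f : (ℕ → X) → α) : Prop :=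
  ∀ ω ω' : ℕ → X, seg ω n = seg ω' n → f ω = f ω'

/-- A supermartingale for an imprecise probability tree `Q`: a bounded-below
extended-real process `M` on situations such that `Q_s(M(s·)) ≤ M(s)` everywhere. -/
def IsSupermartingale {X : Type*} (Q : List X → (X → EReal) → EReal)
    (M : List X → EReal) : Prop :=
  (∃ B : ℝ, ∀ s, (B : EReal) ≤ M s) ∧ ∀ s, Q s (fun x => M (s ++ [x])) ≤ M s

/-- The game-theoretic upper expectation `Ē_V(f | s)`. -/
noncomputable def gUE {X : Type*} (Q : List X → (X → EReal) → EReal)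
    (f : (ℕ → X) → EReal) (s : List X) : EReal :=
  sInf { y | ∃ M : List X → EReal, IsSupermartingale Q M ∧
    (∀ ω ∈ cyl s, f ω ≤ Filter.liminf (fun n => M (seg ω n)) Filter.atTop) ∧ M s = y }

section Segments

variable {X : Type*}

theorem length_seg (ω : ℕ → X) (n : ℕ) : (seg ω n).length = n := by
  simp [seg]

theorem seg_succ (ω : ℕ → X) (n : ℕ) : seg ω (n + 1) = seg ω n ++ [ω n] := by
  rw [seg, List.ofFn_succ_last]
  rfl

theorem take_seg (ω : ℕ → X) {m n : ℕ} (h : m ≤ n) : (seg ω n).take m = seg ω m := by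
  induction n, h using Nat.le_induction with
  | base => exact List.take_of_length_le (length_seg ω m).le
  | succ n hmn ih =>
    rw [seg_succ, List.take_append_of_le_length (by rwa [length_seg]), ih]

theorem seg_mem_cyl (ω : ℕ → X) (n : ℕ) : ω ∈ cyl (seg ω n) := by
  simp [cyl, length_seg]

theorem prefix_seg {ω : ℕ → X} {s : List X} (hω : ω ∈ cyl s) {n : ℕ} (hn : s.length ≤ n) :
    s <+: seg ω n := by
  have h : seg ω s.length = s := hω
  rw [← h, ← take_seg ω hn]
  exact List.take_prefix _ _

theorem mem_cyl_of_prefix {ω : ℕ → X} {s t : List X} (hst : s <+: t) (hω : ω ∈ cyl t) :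
    ω ∈ cyl s := by
  have h : seg ω t.length = t := hω
  show seg ω s.length = s
  rw [← take_seg ω hst.length_le, h]
  exact (List.prefix_iff_eq_take.mp hst).symm

end Segments

theorem bddBelowF_of_nonneg {Y : Type*} {g : Y → EReal} (hg : ∀ y, 0 ≤ g y) : BddBelowF g :=
  ⟨0, by simpa using hg⟩

/-- Upper expectations on a finite space are continuous from below on non-negative functions. -/
theorem IsUpperExpectation.iSup_le {Y : Type*} [Finite Y] {E : (Y → EReal) → EReal}
    (hE : IsUpperExpectation E) (g : ℕ → Y → EReal) (hmono : Monotone g)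
    (hg : ∀ n y, 0 ≤ g n y) :
    E (fun y => ⨆ n, g n y) ≤ ⨆ n, E (g n) := by
  classical
  by_cases hL : (⨆ n, E (g n)) = ⊤
  · rw [hL]; exact le_top
  set ind : Y → EReal := fun y => if (⨆ n, g n y) = ⊤ then 1 else 0 with hind
  have hind0 : ∀ y, 0 ≤ ind y := fun y => by
    simp only [hind]; split_ifs <;> simp
  have hEind0 : 0 ≤ E ind := by
    have h := hE.mono (fun _ => ((0 : ℝ) : EReal)) ind ⟨0, fun _ => le_rfl⟩
      (bddBelowF_of_nonneg hind0) (by simpa using hind0)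
    rwa [hE.const] at h
  have hmul : ∀ K : ℝ, 0 < K → (K : EReal) * E ind ≤ ⨆ n, E (g n) := by
    intro K hK
    have hev : ∀ᶠ n in atTop, ∀ y, (K : EReal) * ind y ≤ g n y := by
      rw [eventually_all]
      intro y
      by_cases hy : (⨆ n, g n y) = ⊤
      · have hlt : (K : EReal) < ⨆ n, g n y := by rw [hy]; exact EReal.coe_lt_top K
        obtain ⟨n, hn⟩ := lt_iSup_iff.mp hlt
        filter_upwards [eventually_ge_atTop n] with m hm
        simpa [hind, hy] using hn.le.trans (hmono hm y)
      · exact Eventually.of_forall fun n => by simpa [hind, hy] using hg n y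
    obtain ⟨n, hn⟩ := hev.exists
    have hK' : (0 : EReal) < K := by exact_mod_cast hK
    rw [← hE.homog K hK' ind (bddBelowF_of_nonneg hind0) hind0]
    exact (hE.mono _ _ (bddBelowF_of_nonneg fun y => mul_nonneg hK'.le (hind0 y))
      (bddBelowF_of_nonneg (hg n)) hn).trans (le_iSup (fun n => E (g n)) n)
  have hEind : E ind = 0 := by
    by_contra hne
    have hpos : 0 < E ind := lt_of_le_of_ne hEind0 (Ne.symm hne)
    obtain ⟨e, he0, he⟩ := EReal.lt_iff_exists_real_btwn.mp hpos
    have he0' : 0 < e := by exact_mod_cast he0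
    refine hL (EReal.eq_top_iff_forall_lt _ |>.mpr fun K => ?_)
    have hK : 0 < (|K| + 1) / e := by positivity
    refine lt_of_lt_of_le ?_ (hmul _ hK)
    refine lt_of_lt_of_le ?_
      (mul_le_mul_of_nonneg_left he.le (by exact_mod_cast hK.le))
    rw [← EReal.coe_mul, div_mul_cancel₀ _ he0'.ne']
    exact_mod_cast lt_of_le_of_lt (le_abs_self K) (lt_add_one _)
  refine EReal.le_of_forall_lt_iff_le.mp fun z hz => ?_
  obtain ⟨l, hl, hlz⟩ := EReal.lt_iff_exists_real_btwn.mp hz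
  have hε : 0 < z - l := by
    have : l < z := by exact_mod_cast hlz
    linarith
  have hev : ∀ᶠ n in atTop, ∀ y,
      (⨆ n, g n y) ≤ (g n y + ((z - l : ℝ) : EReal)) + ⊤ * ind y := by
    rw [eventually_all]
    intro y
    by_cases hy : (⨆ n, g n y) = ⊤
    · refine Eventually.of_forall fun n => ?_
      have hne : g n y + ((z - l : ℝ) : EReal) ≠ ⊥ := by
        refine (lt_of_lt_of_le EReal.bot_lt_zero (add_nonneg (hg n y) ?_)).ne'
        exact_mod_cast hε.le
      have h1 : ind y = 1 := by simp [hind, hy]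
      rw [h1, mul_one, EReal.add_top_of_ne_bot hne]
      exact le_top
    · have h0 : 0 ≤ ⨆ n, g n y := (hg 0 y).trans (le_iSup (fun n => g n y) 0)
      lift (⨆ n, g n y) to ℝ using ⟨hy, (lt_of_lt_of_le EReal.bot_lt_zero h0).ne'⟩ with G hG
      have hlt : ((G - (z - l) : ℝ) : EReal) < ⨆ n, g n y := by
        rw [← hG]; exact_mod_cast sub_lt_self G hε
      obtain ⟨n, hn⟩ := lt_iSup_iff.mp hlt
      filter_upwards [eventually_ge_atTop n] with m hm
      have h1 := add_le_add_left (hn.le.trans (hmono hm y)) ((z - l : ℝ) : EReal)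
      rw [← EReal.coe_add, sub_add_cancel] at h1
      have h2 : ind y = 0 := by simp [hind, ← hG]
      rw [h2, mul_zero, add_zero]
      exact h1
  obtain ⟨n, hn⟩ := hev.exists
  have hε' : (0 : EReal) ≤ ((z - l : ℝ) : EReal) := by exact_mod_cast hε.le
  have b1 : BddBelowF (fun y => g n y + ((z - l : ℝ) : EReal)) :=
    bddBelowF_of_nonneg fun y => add_nonneg (hg n y) hε'
  have b2 : BddBelowF (fun y => ⊤ * ind y) :=
    bddBelowF_of_nonneg fun y => mul_nonneg le_top (hind0 y)
  calc E (fun y => ⨆ n, g n y)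
      ≤ E (fun y => (g n y + ((z - l : ℝ) : EReal)) + ⊤ * ind y) :=
        hE.mono _ _
          (bddBelowF_of_nonneg fun y => (hg 0 y).trans (le_iSup (fun n => g n y) 0))
          (bddBelowF_of_nonneg fun y =>
            add_nonneg (add_nonneg (hg n y) hε') (mul_nonneg le_top (hind0 y))) hn
    _ ≤ E (fun y => g n y + ((z - l : ℝ) : EReal)) + E (fun y => ⊤ * ind y) :=
        hE.subadd _ _ b1 b2
    _ = E (fun y => g n y + ((z - l : ℝ) : EReal)) := by
        rw [hE.homog ⊤ EReal.zero_lt_top ind (bddBelowF_of_nonneg hind0) hind0, hEind,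
          mul_zero, add_zero]
    _ ≤ E (g n) + E (fun _ => ((z - l : ℝ) : EReal)) :=
        hE.subadd _ _ (bddBelowF_of_nonneg (hg n)) (bddBelowF_of_nonneg fun _ => hε')
    _ ≤ (l : EReal) + ((z - l : ℝ) : EReal) := by
        rw [hE.const]
        exact add_le_add_left ((le_iSup (fun n => E (g n)) n).trans hl.le) _
    _ = (z : EReal) := by rw [← EReal.coe_add, add_sub_cancel]

/-- A non-negative supermartingale for the imprecise probability tree `Q`. -/
structure IsNonnegSupermartingale {X : Type*} (Q : List X → (X → EReal) → EReal)
    (M : List X → EReal) : Prop where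
  nonneg : ∀ u, 0 ≤ M u
  le : ∀ u, Q u (fun x => M (u ++ [x])) ≤ M u

namespace IsNonnegSupermartingale

variable {X : Type*} {Q : List X → (X → EReal) → EReal} {M N : List X → EReal}

theorem isSupermartingale (hM : IsNonnegSupermartingale Q M) : IsSupermartingale Q M :=
  ⟨⟨0, by simpa using hM.nonneg⟩, hM.le⟩

theorem const (hQ : ∀ s, IsUpperExpectation (Q s)) {c : ℝ} (hc : 0 ≤ c) :
    IsNonnegSupermartingale Q (fun _ => (c : EReal)) :=
  ⟨fun _ => by exact_mod_cast hc, fun u => ((hQ u).const c).le⟩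

theorem add (hQ : ∀ s, IsUpperExpectation (Q s)) (hM : IsNonnegSupermartingale Q M)
    (hN : IsNonnegSupermartingale Q N) : IsNonnegSupermartingale Q (fun u => M u + N u) :=
  ⟨fun u => add_nonneg (hM.nonneg u) (hN.nonneg u), fun u =>
    ((hQ u).subadd _ _ (bddBelowF_of_nonneg fun _ => hM.nonneg _)
      (bddBelowF_of_nonneg fun _ => hN.nonneg _)).trans (add_le_add (hM.le u) (hN.le u))⟩

theorem const_mul (hQ : ∀ s, IsUpperExpectation (Q s)) (hM : IsNonnegSupermartingale Q M)
    {c : ℝ} (hc : 0 < c) : IsNonnegSupermartingale Q (fun u => (c : EReal) * M u) := by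
  have hc' : (0 : EReal) < c := by exact_mod_cast hc
  refine ⟨fun u => mul_nonneg hc'.le (hM.nonneg u), fun u => ?_⟩
  rw [(hQ u).homog c hc' _ (bddBelowF_of_nonneg fun _ => hM.nonneg _) fun _ => hM.nonneg _]
  exact mul_le_mul_of_nonneg_left (hM.le u) hc'.le

theorem sum (hQ : ∀ s, IsUpperExpectation (Q s)) {T : ℕ → List X → EReal}
    (hT : ∀ k, IsNonnegSupermartingale Q (T k)) (n : ℕ) :
    IsNonnegSupermartingale Q (fun u => ∑ k ∈ Finset.range n, T k u) := by
  induction n with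
  | zero => simpa using const hQ le_rfl
  | succ n ih =>
    simp only [Finset.sum_range_succ]
    exact ih.add hQ (hT n)

theorem iSup [Finite X] (hQ : ∀ s, IsUpperExpectation (Q s)) {S : ℕ → List X → EReal}
    (hS : ∀ n, IsNonnegSupermartingale Q (S n)) (hmono : Monotone S) :
    IsNonnegSupermartingale Q (fun u => ⨆ n, S n u) :=
  ⟨fun u => ((hS 0).nonneg u).trans (le_iSup (fun n => S n u) 0), fun u =>
    ((hQ u).iSup_le (fun n x => S n (u ++ [x])) (fun _ _ h _ => hmono h _)
      fun n _ => (hS n).nonneg _).trans (iSup_mono fun n => (hS n).le u)⟩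

open Classical in
/-- A process that is a non-negative supermartingale after `s` extends to one by `⊤`. -/
theorem extend_top (s : List X) (h0 : ∀ u, s <+: u → 0 ≤ M u)
    (h1 : ∀ u, s <+: u → Q u (fun x => M (u ++ [x])) ≤ M u) :
    IsNonnegSupermartingale Q (fun u => if s <+: u then M u else ⊤) := by
  refine ⟨fun u => ?_, fun u => ?_⟩
  · split_ifs with h
    · exact h0 u h
    · exact le_top
  · by_cases h : s <+: u
    · simp only [h, h.trans (List.prefix_append u _), if_true]
      exact h1 u h
    · simp only [h, if_false, le_top]

/-- Follow `M` until the set `C` of situations is hit in some situation `t`, then switch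
to the supermartingale `N t`. -/
theorem exists_switch (hQ : ∀ s, IsUpperExpectation (Q s)) (hM : IsNonnegSupermartingale Q M)
    (s : List X) (C : Set (List X)) (hC : ∀ t ∈ C, s <+: t) (N : List X → List X → EReal)
    (hN : ∀ t ∈ C, IsNonnegSupermartingale Q (N t)) (hNM : ∀ t ∈ C, N t t ≤ M t) :
    ∃ P : List X → EReal, IsNonnegSupermartingale Q P ∧ P s ≤ M s ∧
      ∀ ω : ℕ → X, (∃ m, seg ω m ∈ C) →
        ∃ m, seg ω m ∈ C ∧ ∀ n ≥ m, P (seg ω n) = N (seg ω m) (seg ω n) := by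
  classical
  set P : List X → EReal := fun u =>
    if h : ∃ k, k ≤ u.length ∧ u.take k ∈ C then N (u.take (Nat.find h)) u else M u with hP
  have hit : ∀ (u : List X) (k : ℕ), k ≤ u.length → u.take k ∈ C →
      (∀ j < k, u.take j ∉ C) → P u = N (u.take k) u := by
    intro u k hk hkC hmin
    have h : ∃ k, k ≤ u.length ∧ u.take k ∈ C := ⟨k, hk, hkC⟩
    have hfind : Nat.find h = k :=
      (Nat.find_eq_iff h).mpr ⟨⟨hk, hkC⟩, fun j hj hj' => hmin j hj hj'.2⟩
    simp only [hP, dif_pos h, hfind]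
  have miss : ∀ u : List X, (∀ k ≤ u.length, u.take k ∉ C) → P u = M u := by
    intro u hu
    have h : ¬ ∃ k, k ≤ u.length ∧ u.take k ∈ C := fun ⟨k, hk, hkC⟩ => hu k hk hkC
    simp only [hP, dif_neg h]
  have first : ∀ u : List X, (∃ k, k ≤ u.length ∧ u.take k ∈ C) →
      ∃ k, k ≤ u.length ∧ u.take k ∈ C ∧ ∀ j < k, u.take j ∉ C := by
    intro u h
    refine ⟨Nat.find h, (Nat.find_spec h).1, (Nat.find_spec h).2, fun j hj hjC => ?_⟩
    exact Nat.find_min h hj ⟨hj.le.trans (Nat.find_spec h).1, hjC⟩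
  have le_of_miss : ∀ u : List X, (∀ k < u.length, u.take k ∉ C) → P u ≤ M u := by
    intro u hu
    by_cases huC : u ∈ C
    · have h := hit u u.length le_rfl (by simpa using huC) hu
      rw [List.take_length] at h
      exact h.le.trans (hNM u huC)
    · refine (miss u fun k hk => ?_).le
      rcases hk.lt_or_eq with hk | rfl
      · exact hu k hk
      · simpa using huC
  have hP0 : ∀ u, 0 ≤ P u := by
    intro u
    by_cases h : ∃ k, k ≤ u.length ∧ u.take k ∈ C
    · obtain ⟨k, hk, hkC, hmin⟩ := first u h
      rw [hit u k hk hkC hmin]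
      exact (hN _ hkC).nonneg u
    · rw [miss u fun k hk hkC => h ⟨k, hk, hkC⟩]
      exact hM.nonneg u
  refine ⟨P, ⟨hP0, fun u => ?_⟩, ?_, ?_⟩
  · by_cases h : ∃ k, k ≤ u.length ∧ u.take k ∈ C
    · obtain ⟨k, hk, hkC, hmin⟩ := first u h
      have htake : ∀ (x : X) (j : ℕ), j ≤ k → (u ++ [x]).take j = u.take j := fun x j hj =>
        List.take_append_of_le_length (hj.trans hk)
      have hstep : ∀ x : X, P (u ++ [x]) = N (u.take k) (u ++ [x]) := by
        intro x
        rw [hit (u ++ [x]) k (by simp; omega) (by rwa [htake x k le_rfl])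
          (fun j hj => by rw [htake x j hj.le]; exact hmin j hj), htake x k le_rfl]
      simp only [hstep, hit u k hk hkC hmin]
      exact (hN _ hkC).le u
    · have hmiss : ∀ k ≤ u.length, u.take k ∉ C := fun k hk hkC => h ⟨k, hk, hkC⟩
      rw [miss u hmiss]
      refine le_trans ((hQ u).mono _ _ (bddBelowF_of_nonneg fun _ => hP0 _)
        (bddBelowF_of_nonneg fun _ => hM.nonneg _) fun x => ?_) (hM.le u)
      refine le_of_miss _ fun k hk => ?_
      have hk' : k ≤ u.length := by simp at hk; omega
      rw [List.take_append_of_le_length hk']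
      exact hmiss k hk'
  · refine le_of_miss s fun k hk hkC => ?_
    have := (hC _ hkC).length_le
    simp at this
    omega
  · intro ω h
    refine ⟨Nat.find h, Nat.find_spec h, fun n hn => ?_⟩
    have := hit (seg ω n) (Nat.find h) (by rwa [length_seg])
      (by rw [take_seg ω hn]; exact Nat.find_spec h)
      (fun j hj => by rw [take_seg ω (hj.le.trans hn)]; exact Nat.find_min h hj)
    rwa [take_seg ω hn] at this

end IsNonnegSupermartingale

/-- `A` can be covered from `s` at cost `c`: some non-negative supermartingale with value at
most `c` in `s` is eventually at least `1` along the paths in `A` through `s`. -/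
def CoverableFrom {X : Type*} (Q : List X → (X → EReal) → EReal) (A : Set (ℕ → X))
    (s : List X) (c : ℝ) : Prop :=
  ∃ T, IsNonnegSupermartingale Q T ∧ T s ≤ (c : EReal) ∧
    ∀ ω ∈ cyl s, ω ∈ A → ∀ᶠ n in atTop, 1 ≤ T (seg ω n)

/-- The paths along which the upper expectation of `f` is below `a` infinitely often, although
`f` exceeds `b`. -/
def gapEvent {X : Type*} (Q : List X → (X → EReal) → EReal) (f : (ℕ → X) → EReal)
    (a b : ℝ) : Set (ℕ → X) :=
  {ω | (∃ᶠ n in atTop, gUE Q f (seg ω n) < a) ∧ (b : EReal) < f ω}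

/-- Countably many events, each coverable from `s` at arbitrarily small cost, admit a common
test supermartingale that converges to `⊤` on all of them. -/
theorem exists_test_supermartingale {X : Type*} [Finite X]
    {Q : List X → (X → EReal) → EReal} (hQ : ∀ s, IsUpperExpectation (Q s))
    {A : ℕ → Set (ℕ → X)} {s : List X}
    (hA : ∀ j, ∀ ε : ℝ, 0 < ε → CoverableFrom Q (A j) s ε) :
    ∃ T, IsNonnegSupermartingale Q T ∧ T s = 1 ∧ ∀ ω ∈ cyl s, ∀ j, ω ∈ A j →
      Tendsto (fun n => T (seg ω n)) atTop (𝓝 (⊤ : EReal)) := by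
  choose T hT hTs hT1 using fun k : ℕ =>
    hA (Nat.unpair k).1 ((1 / 2) ^ (k + 1)) (by positivity)
  set S : ℕ → List X → EReal := fun n u => ∑ k ∈ Finset.range n, T k u with hS
  have hSn : ∀ n, IsNonnegSupermartingale Q (S n) := .sum hQ hT
  have hmono : Monotone S := by
    refine monotone_nat_of_le_succ fun n u => ?_
    simp only [hS, Finset.sum_range_succ]
    exact le_add_of_nonneg_right ((hT n).nonneg u)
  have hSup := IsNonnegSupermartingale.iSup hQ hSn hmono
  have hSs : ∀ n, S n s ≤ ((1 - (1 / 2) ^ n : ℝ) : EReal) := by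
    intro n
    induction n with
    | zero => simp [hS]
    | succ n ih =>
      have h := add_le_add ih (hTs n)
      rw [← EReal.coe_add] at h
      simp only [hS, Finset.sum_range_succ]
      refine h.trans_eq ?_
      congr 1
      ring
  have hle1 : (⨆ n, S n s) ≤ ((1 : ℝ) : EReal) := iSup_le fun n => (hSs n).trans <| by
    have : (0 : ℝ) ≤ (1 / 2) ^ n := by positivity
    exact_mod_cast (by linarith : (1 - (1 / 2) ^ n : ℝ) ≤ 1)
  obtain ⟨v, hv⟩ : ∃ v : ℝ, (v : EReal) = ⨆ n, S n s :=
    ⟨(⨆ n, S n s).toReal, EReal.coe_toReal (hle1.trans_lt (EReal.coe_lt_top 1)).ne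
      (EReal.bot_lt_zero.trans_le (hSup.nonneg s)).ne'⟩
  have hv1 : 0 ≤ 1 - v := by
    rw [← hv] at hle1
    exact sub_nonneg.mpr (by exact_mod_cast hle1)
  refine ⟨fun u => (⨆ n, S n u) + ((1 - v : ℝ) : EReal), hSup.add hQ (.const hQ hv1), ?_,
    fun ω hω j hj => ?_⟩
  · beta_reduce
    rw [← hv, ← EReal.coe_add, add_sub_cancel]
    rfl
  have hbig : ∀ N : ℕ, ∃ K, ∀ᶠ n in atTop, (N : EReal) ≤ S K (seg ω n) := by
    intro N
    induction N with
    | zero => exact ⟨0, Eventually.of_forall fun n => by simp [hS]⟩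
    | succ N ih =>
      obtain ⟨K, hK⟩ := ih
      refine ⟨Nat.pair j K + 1, ?_⟩
      filter_upwards [hK, hT1 (Nat.pair j K) ω hω (by simpa using hj)] with n h1 h2
      have h3 := h1.trans (hmono (Nat.right_le_pair j K) (seg ω n))
      simp only [hS, Finset.sum_range_succ] at h3 ⊢
      push_cast
      exact add_le_add h3 h2
  rw [EReal.tendsto_nhds_top_iff_real]
  intro x
  obtain ⟨N, hN⟩ := exists_nat_gt x
  obtain ⟨K, hK⟩ := hbig N
  filter_upwards [hK] with n hn
  have hxN : (x : EReal) < (N : EReal) := by exact_mod_cast hN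
  calc (x : EReal) < N := hxN
    _ ≤ ⨆ n', S n' (seg ω n) := hn.trans (le_iSup (fun n' => S n' (seg ω n)) K)
    _ ≤ _ := le_add_of_nonneg_right (by exact_mod_cast hv1)

section Levy

variable {X : Type*} [Finite X] [Nonempty X] {Q : List X → (X → EReal) → EReal}

theorem IsSupermartingale.exists_le (hQ : ∀ s, IsUpperExpectation (Q s)) {M : List X → EReal}
    (hM : IsSupermartingale Q M) (u : List X) : ∃ x, M (u ++ [x]) ≤ M u := by
  by_contra! h
  obtain ⟨B, hB⟩ := hM.1
  obtain ⟨x, hx⟩ := Finite.exists_min fun x => M (u ++ [x])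
  obtain ⟨c, hc, hcx⟩ := EReal.lt_iff_exists_real_btwn.mp (h x)
  have hle := (hQ u).mono (fun _ => (c : EReal)) (fun x => M (u ++ [x])) ⟨c, fun _ => le_rfl⟩
    ⟨B, fun _ => hB _⟩ fun y => hcx.le.trans (hx y)
  rw [(hQ u).const] at hle
  exact absurd (hle.trans (hM.2 u)) (not_le.mpr hc)

/-- A supermartingale does not increase along some path through any given situation. -/
theorem IsSupermartingale.exists_path (hQ : ∀ s, IsUpperExpectation (Q s))
    {M : List X → EReal} (hM : IsSupermartingale Q M) (t : List X) :
    ∃ ω ∈ cyl t, ∀ n ≥ t.length, M (seg ω n) ≤ M t := by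
  choose next hnext using hM.exists_le hQ
  let u : ℕ → List X := fun k => (fun v => v ++ [next v])^[k] t
  have hu : ∀ k, u (k + 1) = u k ++ [next (u k)] := fun k =>
    Function.iterate_succ_apply' _ _ _
  have hulen : ∀ k, (u k).length = t.length + k := by
    intro k
    induction k with
    | zero => rfl
    | succ k ih => rw [hu]; simp [ih]; omega
  let ω : ℕ → X := fun n =>
    if h : n < t.length then t[n] else next (u (n - t.length))
  have hω : ω ∈ cyl t := by
    show seg ω t.length = t
    refine List.ext_getElem (length_seg _ _) fun i h1 h2 => ?_
    simp [seg, ω]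
  have hseg : ∀ k, seg ω (t.length + k) = u k := by
    intro k
    induction k with
    | zero => exact hω
    | succ k ih =>
      rw [← add_assoc, seg_succ, ih, hu]
      simp [ω]
  have hle : ∀ k, M (u k) ≤ M t := by
    intro k
    induction k with
    | zero => exact le_rfl
    | succ k ih => rw [hu]; exact (hnext _).trans ih
  refine ⟨ω, hω, fun n hn => ?_⟩
  obtain ⟨k, rfl⟩ := Nat.exists_eq_add_of_le hn
  rw [hseg]
  exact hle k

theorem exists_nonneg_of_gUE_lt (hQ : ∀ s, IsUpperExpectation (Q s)) {f : (ℕ → X) → EReal}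
    {B : ℝ} (hB : ∀ ω, (B : EReal) ≤ f ω) {t : List X} {a : ℝ} (ht : gUE Q f t < a) :
    ∃ M, IsNonnegSupermartingale Q M ∧ M t ≤ ((a - B : ℝ) : EReal) ∧
      ∀ (b : ℝ), ∀ ω ∈ cyl t, (b : EReal) < f ω →
        ∀ᶠ n in atTop, ((b - B : ℝ) : EReal) ≤ M (seg ω n) := by
  classical
  obtain ⟨_, ⟨M, hM, hMf, rfl⟩, hMa⟩ := sInf_lt_iff.mp ht
  have hMB : ∀ u, t <+: u → (B : EReal) ≤ M u := by
    intro u htu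
    obtain ⟨ω, hω, hle⟩ := hM.exists_path hQ u
    refine (hB ω).trans ((hMf ω (mem_cyl_of_prefix htu hω)).trans ?_)
    refine liminf_le_of_frequently_le' (Eventually.frequently ?_)
    filter_upwards [eventually_ge_atTop u.length] with n hn using hle n hn
  refine ⟨fun u => if t <+: u then M u + ((-B : ℝ) : EReal) else ⊤,
    .extend_top t (M := fun u => M u + ((-B : ℝ) : EReal)) (fun u hu => ?_) (fun u hu => ?_),
    ?_, fun b ω hω hb => ?_⟩
  · have := add_le_add_left (hMB u hu) ((-B : ℝ) : EReal)
    rwa [← EReal.coe_add, add_neg_cancel] at this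
  · obtain ⟨D, hD⟩ := hM.1
    refine ((hQ u).subadd _ _ ⟨D, fun _ => hD _⟩ ⟨-B, fun _ => le_rfl⟩).trans ?_
    rw [(hQ u).const]
    exact add_le_add_left (hM.2 u) _
  · beta_reduce
    rw [if_pos (List.prefix_refl t), sub_eq_add_neg, EReal.coe_add]
    exact add_le_add_left hMa.le _
  · filter_upwards [eventually_lt_of_lt_liminf (hb.trans_le (hMf ω hω)),
      eventually_ge_atTop t.length] with n hn hnt
    rw [if_pos (prefix_seg hω hnt), sub_eq_add_neg, EReal.coe_add]
    exact add_le_add_left hn.le _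

theorem CoverableFrom.gapEvent_mul (hQ : ∀ s, IsUpperExpectation (Q s))
    {f : (ℕ → X) → EReal} {B : ℝ} (hB : ∀ ω, (B : EReal) ≤ f ω) {a b : ℝ} (hBa : B < a)
    (hab : a < b) {c : ℝ} (hc : 0 < c) (h : ∀ s, CoverableFrom Q (gapEvent Q f a b) s c)
    (s : List X) : CoverableFrom Q (gapEvent Q f a b) s ((a - B) / (b - B) * c) := by
  classical
  have hp : 0 < a - B := sub_pos.mpr hBa
  have hq : 0 < b - B := by linarith
  have hcq : 0 < c / (b - B) := div_pos hc hq
  choose T hT hTc hT1 using h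
  have hround : ∀ t, ∃ P : List X → EReal, gUE Q f t < a → IsNonnegSupermartingale Q P ∧
      P t ≤ (((a - B) / (b - B) * c : ℝ) : EReal) ∧
      ∀ ω ∈ cyl t, ω ∈ gapEvent Q f a b → ∀ᶠ n in atTop, 1 ≤ P (seg ω n) := by
    intro t
    by_cases ht : gUE Q f t < a
    swap
    · exact ⟨fun _ => 0, fun h => absurd h ht⟩
    obtain ⟨M, hM, hMt, hMb⟩ := exists_nonneg_of_gUE_lt hQ hB ht
    have hcq' : (0 : EReal) ≤ ((c / (b - B) : ℝ) : EReal) := by exact_mod_cast hcq.le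
    obtain ⟨P, hP, hPt, hPω⟩ := (hM.const_mul hQ hcq).exists_switch hQ t
      {u | t <+: u ∧ ((b - B : ℝ) : EReal) ≤ M u} (fun u hu => hu.1) T (fun u _ => hT u)
      (fun u hu => by
        refine (hTc u).trans (le_trans ?_ (mul_le_mul_of_nonneg_left hu.2 hcq'))
        rw [← EReal.coe_mul, div_mul_cancel₀ _ hq.ne'])
    refine ⟨P, fun _ => ⟨hP, hPt.trans ?_, fun ω hω hA => ?_⟩⟩
    · refine (mul_le_mul_of_nonneg_left hMt hcq').trans_eq ?_
      rw [← EReal.coe_mul]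
      congr 1
      ring
    · obtain ⟨m, hm, hmt⟩ := ((hMb b ω hω hA.2).and (eventually_ge_atTop t.length)).exists
      obtain ⟨m, -, hPm⟩ := hPω ω ⟨m, prefix_seg hω hmt, hm⟩
      filter_upwards [hT1 (seg ω m) ω (seg_mem_cyl ω m) hA, eventually_ge_atTop m] with n hn hmn
      rwa [hPm n hmn]
  choose P hP using hround
  have hr : 0 ≤ (a - B) / (b - B) * c := by positivity
  obtain ⟨R, hR, hRs, hRω⟩ := (IsNonnegSupermartingale.const hQ hr).exists_switch hQ s
    {t | s <+: t ∧ gUE Q f t < a} (fun t ht => ht.1) P (fun t ht => (hP t ht.2).1)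
    (fun t ht => (hP t ht.2).2.1)
  refine ⟨R, hR, hRs, fun ω hω hA => ?_⟩
  obtain ⟨m, hm, hms⟩ := (hA.1.and_eventually (eventually_ge_atTop s.length)).exists
  obtain ⟨m, hmC, hRm⟩ := hRω ω ⟨m, prefix_seg hω hms, hm⟩
  filter_upwards [(hP _ hmC.2).2.2 ω (seg_mem_cyl ω m) hA, eventually_ge_atTop m] with n hn hmn
  rwa [hRm n hmn]

theorem coverableFrom_gapEvent (hQ : ∀ s, IsUpperExpectation (Q s))
    {f : (ℕ → X) → EReal} (hb : BddBelowF f) {a b : ℝ} (hab : a < b) {ε : ℝ} (hε : 0 < ε)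
    (s : List X) : CoverableFrom Q (gapEvent Q f a b) s ε := by
  obtain ⟨B₀, hB₀⟩ := hb
  set B := min B₀ (a - 1)
  have hB : ∀ ω, (B : EReal) ≤ f ω := fun ω =>
    le_trans (by exact_mod_cast min_le_left _ _) (hB₀ ω)
  have hBa : B < a := (min_le_right _ _).trans_lt (by linarith)
  have hp : 0 < a - B := sub_pos.mpr hBa
  have hq : 0 < b - B := by linarith
  have hpow : ∀ n : ℕ, ∀ s,
      CoverableFrom Q (gapEvent Q f a b) s (((a - B) / (b - B)) ^ n) := by
    intro n
    induction n with
    | zero =>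
      exact fun s => ⟨fun _ => ((1 : ℝ) : EReal), .const hQ zero_le_one, by simp,
        fun _ _ _ => by simp⟩
    | succ n ih =>
      intro s
      rw [pow_succ']
      exact .gapEvent_mul hQ hB hBa hab (by positivity) ih s
  obtain ⟨n, hn⟩ := exists_pow_lt_of_lt_one hε
    ((div_lt_one hq).mpr (by linarith : a - B < b - B))
  obtain ⟨T, hT, hTs, hT1⟩ := hpow n s
  exact ⟨T, hT, hTs.trans (by exact_mod_cast hn.le), hT1⟩

end Levy

/-- Theorem 3 (Lévy's zero-one law): for bounded-below `f` and any situation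
`s'`, the event `{ω : liminf_n Ē_V(f | ω^n) ≥ f(ω)}` is strictly almost sure
within `Γ(s')`: some `s'`-test supermartingale converges to `+∞` on its
complement within `Γ(s')`. -/
theorem stmt16 {X : Type*} [Fintype X] [Nonempty X]
    (Q : List X → (X → EReal) → EReal) (hQ : ∀ s, IsUpperExpectation (Q s))
    (f : (ℕ → X) → EReal) (hb : BddBelowF f) (s' : List X) :
    ∃ T : List X → EReal, IsSupermartingale Q T ∧ (∀ t, 0 ≤ T t) ∧ T s' = 1 ∧
      ∀ ω ∈ cyl s',
        ¬ (f ω ≤ Filter.liminf (fun n => gUE Q f (seg ω n)) atTop) →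
        Tendsto (fun n => T (seg ω n)) atTop (𝓝 (⊤ : EReal)) := by
  have : Nonempty {p : ℚ × ℚ // p.1 < p.2} := ⟨⟨(0, 1), zero_lt_one⟩⟩
  obtain ⟨e, he⟩ := exists_surjective_nat {p : ℚ × ℚ // p.1 < p.2}
  obtain ⟨T, hT, hT1, hTω⟩ := exists_test_supermartingale hQ (s := s')
    (A := fun j => gapEvent Q f (e j).1.1 (e j).1.2) fun j ε hε =>
      coverableFrom_gapEvent hQ hb (by exact_mod_cast (e j).2) hε s'
  refine ⟨T, hT.isSupermartingale, hT.nonneg, hT1, fun ω hω hlt => ?_⟩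
  obtain ⟨a, ha, haf⟩ := EReal.lt_iff_exists_rat_btwn.mp (not_le.mp hlt)
  obtain ⟨b, hab, hbf⟩ := EReal.lt_iff_exists_rat_btwn.mp haf
  obtain ⟨j, hj⟩ := he ⟨(a, b), by exact_mod_cast hab⟩
  refine hTω ω hω j ?_
  rw [hj]
  exact ⟨frequently_lt_of_liminf_lt (by isBoundedDefault) ha, hbf⟩
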